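/- Shuffle formula for the higher covariant derivative of a wedge product of differential forms: if ω and η are smooth differential forms on M and v_1,…,v_j are smooth vector fields, then ∇^j_{v_1,…,v_j}(ω ∧ η) = Σ_{i=0}^{j} Σ_{σ ∈ Sh(i,j−i)} (∇^i_{v_{σ(1)},…,v_{σ(i)}} ω) ∧ (∇^{j−i}_{v_{σ(i+1)},…,v_{σ(j)}} η), where Sh(p,q) ⊂ S_{p+q} is the set of (p,q) riffle shuffle permutations. -/

import Mathlib

/-!
Algebraic framework for manifolds with connection:
`R` plays the role of the ring of smooth functions `C^∞(M)`,
`V` the `C^∞(M)`-module of smooth vector fields `C^∞(TM)`,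
`VFAct` the action of vector fields on functions as derivations,
`Conn` a connection (covariant derivative) on the module of sections `E`
of a vector bundle, and `hcd` the higher covariant derivative defined
inductively by
`∇^{j+1}_{X₀,…,X_j} α = ∇_{X₀}(∇^j_{X₁,…,X_j} α) − Σ_k ∇^j_{X₁,…,∇̂_{X₀}X_k,…,X_j} α`.
-/

open TensorProduct

/-- The action of vector fields on smooth functions as (ℝ-linear) derivations. -/
structure VFAct (R : Type*) [CommRing R] [Algebra ℝ R]
    (V : Type*) [AddCommGroup V] [Module R V] where
  act : V → R → R
  act_add_right : ∀ X f g, act X (f + g) = act X f + act X g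
  act_mul_right : ∀ X f g, act X (f * g) = act X f * g + f * act X g
  act_add_left : ∀ X Y f, act (X + Y) f = act X f + act Y f
  act_smul_left : ∀ (f : R) X g, act (f • X) g = f * act X g
  act_algebraMap : ∀ X (r : ℝ), act X (algebraMap ℝ R r) = 0

/-- A connection (covariant derivative) on the `R = C^∞(M)`-module `E` of sections of a
smooth vector bundle, relative to the action `D` of vector fields on functions. -/
structure Conn (R : Type*) [CommRing R] [Algebra ℝ R]
    (V : Type*) [AddCommGroup V] [Module R V]
    (E : Type*) [AddCommGroup E] [Module R E]
    (D : VFAct R V) where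
  d : V → E → E
  d_add_right : ∀ X α β, d X (α + β) = d X α + d X β
  d_smul_right : ∀ X (f : R) α, d X (f • α) = D.act X f • α + f • d X α
  d_add_left : ∀ X Y α, d (X + Y) α = d X α + d Y α
  d_smul_left : ∀ (f : R) X α, d (f • X) α = f • d X α

variable {R : Type*} [CommRing R] [Algebra ℝ R]
variable {V : Type*} [AddCommGroup V] [Module R V]

/-- The higher covariant derivative `∇^j_{X₁,…,X_j}` along a tuple of vector fields,
defined inductively by
`∇^{j+1}_{X₀,…,X_j} α = ∇_{X₀}(∇^j_{X₁,…,X_j} α) − Σ_k ∇^j_{X₁,…,∇̂_{X₀}X_k,…,X_j} α`. -/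
def hcd {E : Type*} [AddCommGroup E] [Module R E] {D : VFAct R V}
    (cT : Conn R V V D) (cE : Conn R V E D) : (j : ℕ) → (Fin j → V) → E → E
  | 0, _, α => α
  | j + 1, X, α =>
      cE.d (X 0) (hcd cT cE j (fun k => X k.succ) α)
        - ∑ k : Fin j,
            hcd cT cE j (Function.update (fun m => X m.succ) k (cT.d (X 0) (X k.succ))) α

/-- The connection `∇̂` is torsion-free: `∇̂_X Y − ∇̂_Y X = [X,Y]`, where the Lie bracket
is characterized by its action on functions. -/
def TorsionFree {D : VFAct R V} (cT : Conn R V V D) : Prop :=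
  ∀ X Y f, D.act (cT.d X Y - cT.d Y X) f = D.act X (D.act Y f) - D.act Y (D.act X f)

/-- The higher covariant derivative along those vector fields of the tuple `v` whose index lies
in `S`, taken in increasing order of the index. -/
def hcdOn {E : Type*} [AddCommGroup E] [Module R E] {D : VFAct R V}
    (cT : Conn R V V D) (cE : Conn R V E D) {j : ℕ} (S : Finset (Fin j)) (v : Fin j → V) : E → E :=
  hcd cT cE S.card (v ∘ S.orderEmbOfFin rfl)

/-- `σ` is an `(i, j - i)` riffle shuffle. -/
def IsRiffleShuffle {j : ℕ} (i : ℕ) (σ : Equiv.Perm (Fin j)) : Prop :=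
  (∀ a b : Fin j, a < b → b.val < i → σ a < σ b) ∧
    (∀ a b : Fin j, a < b → i ≤ a.val → σ a < σ b)

namespace Conn

variable {E : Type*} [AddCommGroup E] [Module R E] {D : VFAct R V}

theorem d_zero_right (c : Conn R V E D) (X : V) : c.d X 0 = 0 := by
  have h := c.d_add_right X 0 0
  rw [add_zero] at h
  exact left_eq_add.mp h

theorem d_sum_right (c : Conn R V E D) (X : V) {ι : Type*} (s : Finset ι) (f : ι → E) :
    c.d X (∑ i ∈ s, f i) = ∑ i ∈ s, c.d X (f i) :=
  map_sum (AddMonoidHom.mk ⟨c.d X, c.d_zero_right X⟩ (c.d_add_right X)) f s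

end Conn

theorem Fin.sum_finset_succ {M : Type*} [AddCommMonoid M] {j : ℕ} (f : Finset (Fin (j + 1)) → M) :
    ∑ S, f S = ∑ T : Finset (Fin j), f (T.map (Fin.succEmb j)) +
      ∑ T : Finset (Fin j), f (insert 0 (T.map (Fin.succEmb j))) := by
  have h0 : (0 : Fin (j + 1)) ∉ Finset.univ.map (Fin.succEmb j) := by simp
  have hU : (Finset.univ : Finset (Fin (j + 1))) =
      insert 0 (Finset.univ.map (Fin.succEmb j)) := by
    ext a; cases a using Fin.cases <;> simp
  have key : ∀ g : Finset (Fin (j + 1)) → M,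
      ∑ S ∈ (Finset.univ.map (Fin.succEmb j)).powerset, g S =
        ∑ T : Finset (Fin j), g (T.map (Fin.succEmb j)) := by
    intro g
    symm
    refine Finset.sum_bij (fun T _ => T.map (Fin.succEmb j)) ?_ ?_ ?_ ?_
    · intro T _
      simp
    · intro T _ T' _ h
      exact Finset.map_injective _ h
    · intro S hS
      obtain ⟨T, -, hT⟩ := Finset.subset_map_iff.mp (Finset.mem_powerset.mp hS)
      exact ⟨T, Finset.mem_univ _, hT.symm⟩
    · intros; rfl
  rw [← Finset.powerset_univ, hU, Finset.sum_powerset_insert h0, key,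
    key fun S => f (insert 0 S)]

section hcdOn

variable {E : Type*} [AddCommGroup E] [Module R E] {D : VFAct R V}
  (cT : Conn R V V D) (cE : Conn R V E D)

theorem hcdOn_eq_hcd {j n : ℕ} {S : Finset (Fin j)} (v : Fin j → V) (f : Fin n → Fin j)
    (hf : StrictMono f) (hS : Finset.univ.image f = S) (α : E) :
    hcdOn cT cE S v α = hcd cT cE n (v ∘ f) α := by
  have hn : S.card = n := by
    rw [← hS, Finset.card_image_of_injective _ hf.injective, Finset.card_fin]
  subst hn
  rw [hcdOn, ← Finset.orderEmbOfFin_unique rfl (fun x => ?_) hf]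
  refine hS.subset ?_
  exact Finset.mem_image_of_mem f (Finset.mem_univ x)

theorem hcdOn_map_succ {j : ℕ} (T : Finset (Fin j)) (v : Fin (j + 1) → V) (α : E) :
    hcdOn cT cE (T.map (Fin.succEmb j)) v α = hcdOn cT cE T (fun m => v m.succ) α := by
  rw [hcdOn_eq_hcd cT cE v (Fin.succ ∘ T.orderEmbOfFin rfl)
    ((Fin.strictMono_succ).comp (T.orderEmbOfFin rfl).strictMono)]
  · rfl
  · rw [← Finset.image_image, Finset.image_orderEmbOfFin_univ, Finset.map_eq_image]
    rfl

theorem hcdOn_insert_zero {j : ℕ} (T : Finset (Fin j)) (v : Fin (j + 1) → V) (α : E) :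
    hcdOn cT cE (insert 0 (T.map (Fin.succEmb j))) v α =
      cE.d (v 0) (hcdOn cT cE T (fun m => v m.succ) α) -
        ∑ k ∈ T, hcdOn cT cE T
          (Function.update (fun m => v m.succ) k (cT.d (v 0) (v k.succ))) α := by
  have hmono : StrictMono
      (Fin.cons 0 (Fin.succ ∘ T.orderEmbOfFin rfl) : Fin (T.card + 1) → Fin (j + 1)) := by
    intro a b hab
    cases b using Fin.cases with
    | zero => exact absurd hab (Fin.not_lt_zero a)
    | succ b =>
      cases a using Fin.cases with
      | zero => simp
      | succ a => simpa using hab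
  rw [hcdOn_eq_hcd cT cE v _ hmono]
  · rw [hcd]
    congr 1
    rw [← Finset.sum_coe_sort T, ← (T.orderIsoOfFin rfl).toEquiv.sum_comp]
    refine Finset.sum_congr rfl fun k _ => ?_
    rw [hcdOn]
    congr 1
    exact (Function.update_comp_eq_of_injective (fun m : Fin j => v m.succ)
      (T.orderEmbOfFin rfl).injective k _).symm
  · ext a
    cases a using Fin.cases with
    | zero => simpa using ⟨0, rfl⟩
    | succ a =>
      have ha : a ∈ T ↔ ∃ k, T.orderEmbOfFin rfl k = a := by
        rw [← Finset.mem_coe, ← Finset.range_orderEmbOfFin T rfl, Set.mem_range]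
      simp [Fin.exists_fin_succ, ha, (Fin.succ_ne_zero a).symm]

theorem hcdOn_update_of_notMem {j : ℕ} {T : Finset (Fin j)} {k : Fin j} (hk : k ∉ T)
    (v : Fin j → V) (x : V) (α : E) :
    hcdOn cT cE T (Function.update v k x) α = hcdOn cT cE T v α := by
  rw [hcdOn, hcdOn, Function.update_comp_eq_of_forall_ne]
  rintro i rfl
  exact hk (T.orderEmbOfFin_mem rfl i)

end hcdOn

/-- The Leibniz rule for the higher covariant derivative, as a sum over the subsets of the
index set. -/
theorem hcd_mul {W : Type*} [Ring W] [Algebra R W] {D : VFAct R V}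
    (cT : Conn R V V D) (cW : Conn R V W D)
    (hW : ∀ (X : V) (ω η : W), cW.d X (ω * η) = cW.d X ω * η + ω * cW.d X η)
    (j : ℕ) (v : Fin j → V) (ω η : W) :
    hcd cT cW j v (ω * η) =
      ∑ S : Finset (Fin j), hcdOn cT cW S v ω * hcdOn cT cW Sᶜ v η := by
  induction j with
  | zero =>
    rw [Fintype.sum_unique,
      hcdOn_eq_hcd cT cW v id strictMono_id (Subsingleton.elim _ _),
      hcdOn_eq_hcd cT cW v id strictMono_id (Subsingleton.elim _ _)]
    rfl
  | succ j ih =>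
    rw [Fin.sum_finset_succ, hcd]
    simp_rw [ih]
    rw [cW.d_sum_right, Finset.sum_comm, ← Finset.sum_sub_distrib, ← Finset.sum_add_distrib]
    refine Finset.sum_congr rfl fun T _ => ?_
    have hc₁ : (T.map (Fin.succEmb j))ᶜ = insert 0 (Tᶜ.map (Fin.succEmb j)) := by
      ext a; cases a using Fin.cases <;> simp
    have hc₂ : (insert 0 (T.map (Fin.succEmb j)))ᶜ = Tᶜ.map (Fin.succEmb j) := by
      ext a; cases a using Fin.cases <;> simp
    rw [hc₁, hc₂, hcdOn_map_succ, hcdOn_map_succ, hcdOn_insert_zero, hcdOn_insert_zero, hW,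
      ← Finset.sum_add_sum_compl T]
    have h₁ : ∀ k ∈ T, hcdOn cT cW Tᶜ
        (Function.update (fun m => v m.succ) k (cT.d (v 0) (v k.succ))) η =
          hcdOn cT cW Tᶜ (fun m => v m.succ) η := fun k hk =>
      hcdOn_update_of_notMem cT cW (by simpa using hk) _ _ _
    have h₂ : ∀ k ∈ Tᶜ, hcdOn cT cW T
        (Function.update (fun m => v m.succ) k (cT.d (v 0) (v k.succ))) ω =
          hcdOn cT cW T (fun m => v m.succ) ω := fun k hk =>
      hcdOn_update_of_notMem cT cW (by simpa using hk) _ _ _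
    rw [Finset.sum_congr rfl fun k hk => by rw [h₁ k hk],
      Finset.sum_congr (s₁ := Tᶜ) rfl fun k hk => by rw [h₂ k hk],
      ← Finset.sum_mul, ← Finset.mul_sum, sub_mul, mul_sub]
    abel

namespace IsRiffleShuffle

variable {j i : ℕ} {σ : Equiv.Perm (Fin j)}

theorem strictMono_left (hσ : IsRiffleShuffle i σ) (hi : i ≤ j) :
    StrictMono fun k : Fin i => σ ⟨k.val, k.isLt.trans_le hi⟩ :=
  fun _ b hab => hσ.1 _ _ hab b.isLt

theorem strictMono_right (hσ : IsRiffleShuffle i σ) :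
    StrictMono fun k : Fin (j - i) => σ ⟨i + k.val, by have := k.isLt; omega⟩ :=
  fun a _ hab => hσ.2 _ _ (Nat.add_lt_add_left hab i) (Nat.le_add_right i a)

end IsRiffleShuffle

/-- The values that a permutation takes on the first `i` positions. -/
def shuffleSet {j : ℕ} (i : ℕ) (σ : Equiv.Perm (Fin j)) : Finset (Fin j) :=
  Finset.univ.filter fun a => (σ.symm a).val < i

section shuffleSet

variable {j i : ℕ}

theorem image_left_eq_shuffleSet (σ : Equiv.Perm (Fin j)) (hi : i ≤ j) :
    Finset.univ.image (fun k : Fin i => σ ⟨k.val, k.isLt.trans_le hi⟩) = shuffleSet i σ := by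
  ext a
  simp only [shuffleSet, Finset.mem_image, Finset.mem_univ, true_and, Finset.mem_filter]
  constructor
  · rintro ⟨k, rfl⟩
    simp
  · intro h
    exact ⟨⟨_, h⟩, by simp⟩

theorem image_right_eq_compl_shuffleSet (σ : Equiv.Perm (Fin j)) :
    Finset.univ.image (fun k : Fin (j - i) => σ ⟨i + k.val, by have := k.isLt; omega⟩) =
      (shuffleSet i σ)ᶜ := by
  ext a
  simp only [shuffleSet, Finset.mem_image, Finset.mem_univ, true_and, Finset.mem_filter,
    Finset.mem_compl, not_lt]
  constructor
  · rintro ⟨k, rfl⟩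
    simp
  · intro h
    refine ⟨⟨(σ.symm a).val - i, by have := (σ.symm a).isLt; omega⟩, ?_⟩
    rw [← Equiv.eq_symm_apply]
    ext
    simp only
    omega

theorem card_shuffleSet (σ : Equiv.Perm (Fin j)) (hi : i ≤ j) : (shuffleSet i σ).card = i := by
  rw [← image_left_eq_shuffleSet σ hi, Finset.card_image_of_injective, Finset.card_fin]
  intro a b h
  simpa [Fin.ext_iff] using h

theorem IsRiffleShuffle.ext {σ τ : Equiv.Perm (Fin j)} (hσ : IsRiffleShuffle i σ)
    (hτ : IsRiffleShuffle i τ) (hi : i ≤ j) (h : shuffleSet i σ = shuffleSet i τ) : σ = τ := by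
  have hl := (hσ.strictMono_left hi).range_inj (hτ.strictMono_left hi) |>.mp (by
    have := congrArg (fun S : Finset (Fin j) => (S : Set (Fin j)))
      ((image_left_eq_shuffleSet σ hi).trans (h.trans (image_left_eq_shuffleSet τ hi).symm))
    simpa using this)
  have hr := hσ.strictMono_right.range_inj hτ.strictMono_right |>.mp (by
    have := congrArg (fun S : Finset (Fin j) => (S : Set (Fin j)))
      ((image_right_eq_compl_shuffleSet σ).trans
        ((congrArg _ h).trans (image_right_eq_compl_shuffleSet τ).symm))
    simpa using this)
  refine Equiv.ext fun a => ?_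
  by_cases ha : a.val < i
  · exact congrFun hl ⟨a, ha⟩
  · have ha' : i + (a.val - i) = a.val := by omega
    have := congrFun hr ⟨a.val - i, by have := a.isLt; omega⟩
    simpa only [ha'] using this

theorem exists_isRiffleShuffle (S : Finset (Fin j)) :
    ∃ σ : Equiv.Perm (Fin j), IsRiffleShuffle S.card σ ∧ shuffleSet S.card σ = S := by
  have hj : j = S.card + Sᶜ.card := by rw [Finset.card_add_card_compl, Fintype.card_fin]
  let σ : Equiv.Perm (Fin j) :=
    (finCongr hj).trans (finSumFinEquiv.symm.trans (finSumEquivOfFinset rfl rfl))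
  have hl : ∀ (a : Fin j) (h : a.val < S.card), σ a = S.orderEmbOfFin rfl ⟨a, h⟩ := by
    intro a h
    have : finCongr hj a = Fin.castAdd _ ⟨a, h⟩ := rfl
    simp only [σ, Equiv.trans_apply, this, finSumFinEquiv_symm_apply_castAdd,
      finSumEquivOfFinset_inl]
  have hr : ∀ (a : Fin j) (h : S.card ≤ a.val),
      σ a = Sᶜ.orderEmbOfFin rfl ⟨a - S.card, by have := a.isLt; omega⟩ := by
    intro a h
    have : finCongr hj a = Fin.natAdd _ ⟨a - S.card, by have := a.isLt; omega⟩ := by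
      ext
      simp only [finCongr_apply, Fin.val_cast, Fin.natAdd_mk]
      omega
    simp only [σ, Equiv.trans_apply, this, finSumFinEquiv_symm_apply_natAdd,
      finSumEquivOfFinset_inr]
  refine ⟨σ, ⟨fun a b hab hb => ?_, fun a b hab ha => ?_⟩, ?_⟩
  · have hab' : a.val < b.val := hab
    rw [hl a (hab'.trans hb), hl b hb]
    exact (S.orderEmbOfFin rfl).strictMono hab
  · have hab' : a.val < b.val := hab
    rw [hr a ha, hr b (ha.trans hab'.le)]
    refine (Sᶜ.orderEmbOfFin rfl).strictMono ?_
    rw [Fin.mk_lt_mk]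
    omega
  · ext x
    obtain ⟨a, rfl⟩ := σ.surjective x
    simp only [shuffleSet, Finset.mem_filter, Finset.mem_univ, true_and, Equiv.symm_apply_apply]
    by_cases h : a.val < S.card
    · simp only [h, hl a h, Finset.orderEmbOfFin_mem]
    · have hm := Sᶜ.orderEmbOfFin_mem rfl ⟨a - S.card, by have := a.isLt; omega⟩
      rw [← hr a (not_lt.mp h), Finset.mem_compl] at hm
      simp only [h, hm]

open scoped Classical in
theorem sum_isRiffleShuffle {M : Type*} [AddCommMonoid M] (F : Finset (Fin j) → M) :
    ∑ i : Fin (j + 1), ∑ σ : Equiv.Perm (Fin j),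
      (if IsRiffleShuffle i.val σ then F (shuffleSet i.val σ) else 0) = ∑ S, F S := by
  rw [← Fintype.sum_prod_type', ← Finset.sum_filter]
  refine Finset.sum_bij (fun p _ => shuffleSet p.1.val p.2) (fun _ _ => Finset.mem_univ _)
    ?_ ?_ (fun _ _ => rfl)
  · rintro ⟨i, σ⟩ hσ ⟨i', τ⟩ hτ h
    simp only [Finset.mem_filter, Finset.mem_univ, true_and] at hσ hτ h
    have hi : i = i' := by
      ext
      rw [← card_shuffleSet σ (Nat.lt_succ_iff.mp i.isLt), h,
        card_shuffleSet τ (Nat.lt_succ_iff.mp i'.isLt)]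
    subst hi
    rw [hσ.ext hτ (Nat.lt_succ_iff.mp i.isLt) h]
  · intro S _
    obtain ⟨σ, hσ, hS⟩ := exists_isRiffleShuffle S
    exact ⟨(⟨S.card, Nat.lt_succ_iff.mpr (card_finset_fin_le S)⟩, σ), by simpa using hσ, hS⟩

end shuffleSet

open scoped Classical in
/-- Shuffle formula for the higher covariant derivative of a wedge
product of differential forms.  Here `W` plays the role of the algebra of smooth
differential forms on `M` (with product the wedge product), and `cW` is a connection
on `W` satisfying the Leibniz rule `∇_X(ω ∧ η) = (∇_X ω) ∧ η + ω ∧ (∇_X η)` (the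
extension of the dual connection to forms).  Then for all vector fields `v₁,…,v_j`:
`∇^j_{v₁,…,v_j}(ω ∧ η) = Σ_{i=0}^{j} Σ_{σ ∈ Sh(i,j−i)}
  (∇^i_{v_{σ(1)},…,v_{σ(i)}} ω) ∧ (∇^{j−i}_{v_{σ(i+1)},…,v_{σ(j)}} η)`,
where `Sh(p,q)` is the set of `(p,q)` riffle shuffles, i.e. permutations `σ` of
`{1,…,p+q}` with `σ(1) < ⋯ < σ(p)` and `σ(p+1) < ⋯ < σ(p+q)`. -/
theorem statement2
    {R : Type*} [CommRing R] [Algebra ℝ R]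
    {V : Type*} [AddCommGroup V] [Module R V]
    {W : Type*} [Ring W] [Algebra R W]
    {D : VFAct R V} (cT : Conn R V V D) (cW : Conn R V W D)
    (hW : ∀ (X : V) (ω η : W), cW.d X (ω * η) = cW.d X ω * η + ω * cW.d X η) :
    ∀ (j : ℕ) (v : Fin j → V) (ω η : W),
      hcd cT cW j v (ω * η) =
        ∑ i : Fin (j + 1), ∑ σ : Equiv.Perm (Fin j),
          if ((∀ a b : Fin j, a < b → b.val < i.val → σ a < σ b) ∧
              (∀ a b : Fin j, a < b → i.val ≤ a.val → σ a < σ b)) then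
            hcd cT cW i.val
                (fun k : Fin i.val =>
                  v (σ ⟨k.val, lt_of_lt_of_le k.isLt (Nat.lt_succ_iff.mp i.isLt)⟩)) ω
              * hcd cT cW (j - i.val)
                  (fun k : Fin (j - i.val) =>
                    v (σ ⟨i.val + k.val, by
                        have hk := k.isLt
                        have hi := i.isLt
                        omega⟩)) η
          else 0 := by
  intro j v ω η
  rw [hcd_mul cT cW hW, ← sum_isRiffleShuffle]
  refine Finset.sum_congr rfl fun i _ => Finset.sum_congr rfl fun σ _ => ?_
  have hi : i.val ≤ j := Nat.lt_succ_iff.mp i.isLt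
  by_cases hσ : IsRiffleShuffle i.val σ
  · refine Eq.trans ?_ (if_pos hσ).symm
    rw [if_pos hσ,
      hcdOn_eq_hcd cT cW v _ (hσ.strictMono_left hi) (image_left_eq_shuffleSet σ hi),
      hcdOn_eq_hcd cT cW v _ hσ.strictMono_right (image_right_eq_compl_shuffleSet σ)]
    rfl
  · exact (if_neg hσ).trans (if_neg hσ).symm
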